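/- Define Λ(ξ) := ξ₃/‖ξ‖ for ξ ≠ 0, write ξ_h := (ξ₁,ξ₂,0), and σ̄(ξ,η) := ξ₃η_h − η₃ξ_h. There exists a universal constant c > 0 with the following property. Let ξ, η ∈ ℝ³ with ξ ≠ 0, η ≠ 0, ξ ≠ η, let μ, ν ∈ {−1,+1}, and set M := max{ |Λ(ξ)|, |Λ(ξ−η)|, |Λ(η)| }. If |Λ(ξ) + μ·Λ(ξ−η) + ν·Λ(η)| ≤ M/4, then (i) max{ √(1−Λ(ξ)²), √(1−Λ(ξ−η)²), √(1−Λ(η)²) } ≥ c, and (ii) ‖σ̄(ξ,η)‖ ≥ c · M · max{‖ξ‖, ‖ξ−η‖, ‖η‖} · min{‖ξ‖, ‖ξ−η‖, ‖η‖}. -/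

import Mathlib

open MeasureTheory RealInnerProductSpace

noncomputable section

/-- Euclidean 3-space. -/
abbrev E3 : Type := EuclideanSpace ℝ (Fin 3)

/-- The vector `(a, b, c) ∈ ℝ³`. -/
def Ev3 (a b c : ℝ) : E3 := (WithLp.equiv 2 (Fin 3 → ℝ)).symm ![a, b, c]

/-- Horizontal part `v_h = (v₁, v₂, 0)` of a vector `v ∈ ℝ³`. -/
def hpart (v : E3) : E3 := Ev3 (v 0) (v 1) 0

/-- Horizontal rotation by 90 degrees: `v_h^⊥ = (−v₂, v₁, 0)`. -/
def hperp (v : E3) : E3 := Ev3 (-(v 1)) (v 0) 0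

/-- The quantity `σ̄(ξ,η) := ξ₃ η_h − η₃ ξ_h`. -/
def sigmaBar (ξ η : E3) : E3 := (ξ 2) • hpart η - (η 2) • hpart ξ

/-- The dispersion relation `Λ(ξ) = ξ₃ / ‖ξ‖`. -/
def Lam (ξ : E3) : ℝ := ξ 2 / ‖ξ‖

/-- `s(ξ) := √(1 − Λ(ξ)²)`. -/
def sfun (ξ : E3) : ℝ := Real.sqrt (1 - Lam ξ ^ 2)

/-- The vertical unit vector `e₃`. -/
def e₃ : E3 := Ev3 0 0 1

/-- The direction `w(ξ) = (Λ(ξ)/s(ξ)) ξ_h − ‖ξ‖ s(ξ) e₃` of the vector field `Υ = ∂_φ`. -/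
def wvec (ξ : E3) : E3 := (Lam ξ / sfun ξ) • hpart ξ - (‖ξ‖ * sfun ξ) • e₃

theorem norm_hpart_sq (x : E3) : ‖hpart x‖ ^ 2 = ‖x‖ ^ 2 - x 2 ^ 2 := by
  rw [EuclideanSpace.norm_sq_eq, EuclideanSpace.norm_sq_eq]
  simp [Fin.sum_univ_three, hpart, Ev3]

theorem sigmaBar_sub_left (ξ η : E3) : sigmaBar (ξ - η) η = sigmaBar ξ η := by
  ext i
  fin_cases i <;> simp [sigmaBar, hpart, Ev3] <;> ring

theorem norm_sigmaBar_sub_right (ξ η : E3) : ‖sigmaBar ξ (ξ - η)‖ = ‖sigmaBar ξ η‖ := by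
  rw [← norm_neg]
  congr 1
  ext i
  fin_cases i <;> simp [sigmaBar, hpart, Ev3] <;> ring

theorem abs_sub_le_abs_mul_sub_mul {a b h k r s : ℝ} (ha : 0 ≤ a) (hb : 0 ≤ b)
    (hh : 0 ≤ h) (hk : 0 ≤ k) (hr : 0 < r) (hs : 0 < s)
    (hhr : h ^ 2 = r ^ 2 - a ^ 2) (hks : k ^ 2 = s ^ 2 - b ^ 2) :
    |a * s - b * r| ≤ |a * k - b * h| := by
  have hhr' : h ≤ r := abs_le_of_sq_le_sq' (by nlinarith) hr.le |>.2
  have hks' : k ≤ s := abs_le_of_sq_le_sq' (by nlinarith) hs.le |>.2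
  have hle : a * k + b * h ≤ a * s + b * r := by gcongr
  have hprod : |a * k - b * h| * (a * k + b * h) = |a * s - b * r| * (a * s + b * r) := by
    rw [← abs_of_nonneg (show 0 ≤ a * k + b * h by positivity),
      ← abs_of_nonneg (show 0 ≤ a * s + b * r by positivity), ← abs_mul, ← abs_mul]
    congr 1
    linear_combination a ^ 2 * hks - b ^ 2 * hhr
  rcases (show 0 ≤ a * s + b * r by positivity).eq_or_lt with h0 | hpos
  · have h1 : a * s = 0 := by nlinarith [mul_nonneg ha hs.le, mul_nonneg hb hr.le]
    have h2 : b * r = 0 := by linarith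
    simp [h1, h2]
  · refine le_of_mul_le_mul_right ?_ hpos
    rw [← hprod]
    gcongr

/-- `σ̄` controls the difference of the moduli of the dispersion relations. -/
theorem abs_abs_Lam_sub_mul_le {x y : E3} (hx : x ≠ 0) (hy : y ≠ 0) :
    |(|Lam x| - |Lam y|)| * (‖x‖ * ‖y‖) ≤ ‖sigmaBar x y‖ := by
  have hx' := norm_pos_iff.2 hx
  have hy' := norm_pos_iff.2 hy
  calc |(|Lam x| - |Lam y|)| * (‖x‖ * ‖y‖)
      = |(|x 2| * ‖y‖ - |y 2| * ‖x‖)| := by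
        rw [← abs_of_pos (mul_pos hx' hy'), ← abs_mul]
        congr 1
        simp only [Lam, abs_div, abs_norm]
        field_simp
    _ ≤ |(|x 2| * ‖hpart y‖ - |y 2| * ‖hpart x‖)| :=
        abs_sub_le_abs_mul_sub_mul (abs_nonneg _) (abs_nonneg _) (norm_nonneg _) (norm_nonneg _)
          hx' hy' (by rw [norm_hpart_sq, sq_abs]) (by rw [norm_hpart_sq, sq_abs])
    _ ≤ ‖sigmaBar x y‖ := by
        simpa only [norm_smul, Real.norm_eq_abs, sigmaBar] using
          abs_norm_sub_norm_le (x 2 • hpart y) (y 2 • hpart x)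

theorem max_mul_min_le_two_mul {a b c : ℝ} (ha : 0 ≤ a) (hb : 0 ≤ b) (hc : 0 ≤ c)
    (h : c ≤ a + b) : max a (max b c) * min a (min b c) ≤ 2 * (a * b) := by
  have hm : 0 ≤ min a (min b c) := le_min ha (le_min hb hc)
  rcases le_total a b with hab | hab
  · calc max a (max b c) * min a (min b c) ≤ (2 * b) * a :=
          mul_le_mul (max_le (by linarith) (max_le (by linarith) (by linarith)))
            (min_le_left _ _) hm (by linarith)
      _ = 2 * (a * b) := by ring
  · calc max a (max b c) * min a (min b c) ≤ (2 * a) * b :=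
          mul_le_mul (max_le (by linarith) (max_le (by linarith) (by linarith)))
            ((min_le_right _ _).trans (min_le_left _ _)) hm (by linarith)
      _ = 2 * (a * b) := by ring

/-- A signed sum of three reals of nearly equal modulus cannot be small. -/
theorem quarter_max_le_of_abs_add_le {a b c d μ ν : ℝ} (hμ : μ = -1 ∨ μ = 1)
    (hν : ν = -1 ∨ ν = 1) (h : |a + μ * b + ν * c| ≤ max |a| (max |b| |c|) / 4)
    (hab : |(|a| - |b|)| ≤ d) (hac : |(|a| - |c|)| ≤ d) (hbc : |(|b| - |c|)| ≤ d) :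
    max |a| (max |b| |c|) / 4 ≤ d := by
  have hM : max |a| (max |b| |c|) = |a| ∨ max |a| (max |b| |c|) = |b| ∨
      max |a| (max |b| |c|) = |c| := by
    rcases max_choice |a| (max |b| |c|) with h | h
    · exact Or.inl h
    · rw [h]; exact Or.inr (max_choice _ _)
  have ha := le_max_left |a| (max |b| |c|)
  have hb := (le_max_left |b| |c|).trans (le_max_right |a| _)
  have hc := (le_max_right |b| |c|).trans (le_max_right |a| _)
  generalize max |a| (max |b| |c|) = M at *
  rw [abs_le] at h hab hac hbc
  rcases hμ with rfl | rfl <;> rcases hν with rfl | rfl <;>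
    rcases abs_cases a with ⟨ea, _⟩ | ⟨ea, _⟩ <;> rcases abs_cases b with ⟨eb, _⟩ | ⟨eb, _⟩ <;>
    rcases abs_cases c with ⟨ec, _⟩ | ⟨ec, _⟩ <;>
    rcases hM with e | e | e <;> linarith

theorem abs_Lam_le_one (x : E3) : |Lam x| ≤ 1 := by
  rw [Lam, abs_div, abs_norm]
  exact div_le_one_of_le₀ (by simpa using PiLp.norm_apply_le x 2) (norm_nonneg x)

theorem lt_abs_of_sqrt_one_sub_sq_lt {t : ℝ} (h : √(1 - t ^ 2) < 1 / 8) : 7 / 8 < |t| := by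
  rw [Real.sqrt_lt' (by norm_num)] at h
  by_contra! ht
  have := sq_abs t
  nlinarith [abs_nonneg t]

/-- **Small phase forces a lower bound on `σ̄` (Proposition 6.3).**
There is a universal `c > 0` such that whenever `ξ, η, ξ−η` are nonzero, `μ, ν ∈ {−1,+1}`, and
`|Λ(ξ) + μΛ(ξ−η) + νΛ(η)| ≤ M/4` with `M = max{|Λ(ξ)|,|Λ(ξ−η)|,|Λ(η)|}`, then
(i) `max √(1−Λ²) ≥ c`, and (ii) `‖σ̄(ξ,η)‖ ≥ c · M · max‖·‖ · min‖·‖`. -/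
theorem stmt_11 :
    ∃ c : ℝ, 0 < c ∧
      ∀ (ξ η : E3), ξ ≠ 0 → η ≠ 0 → ξ ≠ η →
      ∀ μ ν : ℝ, (μ = -1 ∨ μ = 1) → (ν = -1 ∨ ν = 1) →
      |Lam ξ + μ * Lam (ξ - η) + ν * Lam η|
          ≤ max |Lam ξ| (max |Lam (ξ - η)| |Lam η|) / 4 →
      (c ≤ max (Real.sqrt (1 - Lam ξ ^ 2))
            (max (Real.sqrt (1 - Lam (ξ - η) ^ 2)) (Real.sqrt (1 - Lam η ^ 2)))) ∧
      c * max |Lam ξ| (max |Lam (ξ - η)| |Lam η|)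
          * max ‖ξ‖ (max ‖ξ - η‖ ‖η‖) * min ‖ξ‖ (min ‖ξ - η‖ ‖η‖)
        ≤ ‖sigmaBar ξ η‖ := by
  refine ⟨1 / 8, by norm_num, fun ξ η hξ hη hne μ ν hμ hν h => ⟨?_, ?_⟩⟩
  · by_contra! hlt
    simp only [max_lt_iff] at hlt
    have hab := lt_abs_of_sqrt_one_sub_sq_lt hlt.1
    have hbb := lt_abs_of_sqrt_one_sub_sq_lt hlt.2.1
    have hcb := lt_abs_of_sqrt_one_sub_sq_lt hlt.2.2
    have ha := abs_Lam_le_one ξ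
    have hb := abs_Lam_le_one (ξ - η)
    have hc := abs_Lam_le_one η
    have := quarter_max_le_of_abs_add_le (d := 1 / 8) hμ hν h
      (abs_le.2 ⟨by linarith, by linarith⟩) (abs_le.2 ⟨by linarith, by linarith⟩)
      (abs_le.2 ⟨by linarith, by linarith⟩)
    linarith [le_max_left |Lam ξ| (max |Lam (ξ - η)| |Lam η|)]
  · have hsub : ξ - η ≠ 0 := sub_ne_zero.2 hne
    have hx := norm_pos_iff.2 hξ
    have hy := norm_pos_iff.2 hsub
    have hz := norm_pos_iff.2 hη
    have t1 : ‖η‖ ≤ ‖ξ‖ + ‖ξ - η‖ := by simpa using norm_sub_le ξ (ξ - η)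
    have t2 : ‖ξ - η‖ ≤ ‖ξ‖ + ‖η‖ := norm_sub_le ξ η
    have t3 : ‖ξ‖ ≤ ‖ξ - η‖ + ‖η‖ := by simpa using norm_add_le (ξ - η) η
    have p1 := max_mul_min_le_two_mul hx.le hy.le hz.le t1
    have p2 := max_mul_min_le_two_mul hx.le hz.le hy.le t2
    have p3 := max_mul_min_le_two_mul hy.le hz.le hx.le t3
    rw [max_comm ‖η‖, min_comm ‖η‖] at p2
    rw [max_left_comm, min_left_comm, ← max_assoc, ← min_assoc, max_comm, min_comm,
      max_comm ‖η‖, min_comm ‖η‖] at p3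
    have s1 := abs_abs_Lam_sub_mul_le hξ hsub
    have s2 := abs_abs_Lam_sub_mul_le hξ hη
    have s3 := abs_abs_Lam_sub_mul_le hsub hη
    rw [norm_sigmaBar_sub_right] at s1
    rw [sigmaBar_sub_left] at s3
    have hP : 0 < max ‖ξ‖ (max ‖ξ - η‖ ‖η‖) * min ‖ξ‖ (min ‖ξ - η‖ ‖η‖) :=
      mul_pos (lt_max_of_lt_left hx) (lt_min hx (lt_min hy hz))
    rw [mul_assoc]
    generalize max ‖ξ‖ (max ‖ξ - η‖ ‖η‖) * min ‖ξ‖ (min ‖ξ - η‖ ‖η‖) = P at *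
    have key : ∀ t q : ℝ, |t| * q ≤ ‖sigmaBar ξ η‖ → P ≤ 2 * q →
        |t| ≤ 2 * ‖sigmaBar ξ η‖ / P := fun t q ht hq => by
      rw [le_div_iff₀ hP]
      linarith [mul_le_mul_of_nonneg_left hq (abs_nonneg t)]
    have := quarter_max_le_of_abs_add_le hμ hν h (key _ _ s1 p1) (key _ _ s2 p2) (key _ _ s3 p3)
    rw [le_div_iff₀ hP] at this
    linarith
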